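/- In the smooth setting described below, the initial vorticity determines the time derivative of the Beltrami coefficient of the flow at time zero: with μ(t,z) = ∂̄X(t,z)/∂X(t,z), for every z ∈ ℂ one has (d/dt) μ(t,z) |_{t=0} = ∂̄v(0,z) = e^{iθ} ω₀(z)/2. -/

import Mathlib

open MeasureTheory Complex ENNReal

/-- The Cauchy-type kernel `K(z) = e^{iθ}/(2πz)`. -/
noncomputable def Kker (θ : ℝ) (z : ℂ) : ℂ :=
  Complex.exp (θ * Complex.I) / (2 * Real.pi * z)

/-- The convolution `(K∗f)(x) = ∫ K(x−y) f(y) dA(y)` against Lebesgue measure on `ℂ`. -/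
noncomputable def Kconv (θ : ℝ) (f : ℂ → ℂ) (x : ℂ) : ℂ :=
  ∫ y, Kker θ (x - y) * f y

/-- The Wirtinger derivative `∂F = (∂_x F − i ∂_y F)/2` of `F : ℂ → ℂ` (real `fderiv`). -/
noncomputable def wdz (F : ℂ → ℂ) (z : ℂ) : ℂ :=
  (fderiv ℝ F z 1 - Complex.I * fderiv ℝ F z Complex.I) / 2

/-- The Wirtinger derivative `∂̄F = (∂_x F + i ∂_y F)/2` of `F : ℂ → ℂ` (real `fderiv`). -/
noncomputable def wdbar (F : ℂ → ℂ) (z : ℂ) : ℂ :=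
  (fderiv ℝ F z 1 + Complex.I * fderiv ℝ F z Complex.I) / 2

/-- The sup norm `‖g‖_∞ = sup_z |g z|` of a real valued function on `ℂ`. -/
noncomputable def supNorm (g : ℂ → ℝ) : ℝ := ⨆ z : ℂ, |g z|

/-- The smooth setting of Section 2: `θ ∈ [0,2π]`, `T > 0`, a smooth compactly supported
datum `ω₀`, a smooth compactly supported (in space) solution `ω` of the active scalar
equation `∂_t ω + v·∇ω = 0`, `v(t,·) = K∗ω(t,·)`, `ω(0,·) = ω₀`, and its smooth flow
`X` solving `∂_t X(t,z) = v(t,X(t,z))`, `X(0,z) = z`, where each `X(t,·)` is a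
bijective `C¹` map with everywhere positive Jacobian determinant. -/
structure SmoothSetting where
  θ : ℝ
  hθ : θ ∈ Set.Icc (0 : ℝ) (2 * Real.pi)
  T : ℝ
  hT : 0 < T
  ω₀ : ℂ → ℝ
  hω₀smooth : ContDiff ℝ (⊤ : ℕ∞) ω₀
  hω₀supp : HasCompactSupport ω₀
  ω : ℝ → ℂ → ℝ
  hωsmooth : ContDiff ℝ (⊤ : ℕ∞) (fun p : ℝ × ℂ => ω p.1 p.2)
  hωsupp : ∀ t : ℝ, HasCompactSupport (ω t)
  hωinit : ω 0 = ω₀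
  htransport : ∀ t ∈ Set.Icc (0 : ℝ) T, ∀ z : ℂ,
    deriv (fun s => ω s z) t
      + (Kconv θ (fun y => (ω t y : ℂ)) z).re * fderiv ℝ (ω t) z 1
      + (Kconv θ (fun y => (ω t y : ℂ)) z).im * fderiv ℝ (ω t) z Complex.I = 0
  X : ℝ → ℂ → ℂ
  hXsmooth : ContDiff ℝ (⊤ : ℕ∞) (fun p : ℝ × ℂ => X p.1 p.2)
  hXinit : ∀ z : ℂ, X 0 z = z
  hXflow : ∀ t ∈ Set.Icc (0 : ℝ) T, ∀ z : ℂ,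
    deriv (fun s => X s z) t = Kconv θ (fun y => (ω t y : ℂ)) (X t z)
  hXbij : ∀ t ∈ Set.Icc (0 : ℝ) T, Function.Bijective (X t)
  hXjac : ∀ t ∈ Set.Icc (0 : ℝ) T, ∀ z : ℂ,
    0 < LinearMap.det ((fderiv ℝ (X t) z) : ℂ →ₗ[ℝ] ℂ)

/-- A continuous function of `(r, φ)` vanishing for large `r` is integrable over the domain of
polar coordinates. -/
lemma integrableOn_polar_of_continuous {F : ℝ × ℝ → ℂ} (hF : Continuous F) {R : ℝ}
    (hR : ∀ p : ℝ × ℝ, R < p.1 → F p = 0) :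
    IntegrableOn F (Set.Ioi (0 : ℝ) ×ˢ Set.Ioo (-Real.pi) Real.pi) := by
  have h : IntegrableOn F (Set.Icc 0 R ×ˢ Set.Icc (-Real.pi) Real.pi) :=
    hF.continuousOn.integrableOn_compact (isCompact_Icc.prod isCompact_Icc)
  refine h.of_forall_sdiff_eq_zero (measurableSet_Ioi.prod measurableSet_Ioo) ?_
  rintro ⟨r, φ⟩ ⟨⟨h1, h2⟩, h3⟩
  refine hR _ (not_le.1 fun hr => h3 ⟨⟨le_of_lt h1, hr⟩, le_of_lt h2.1, le_of_lt h2.2⟩)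

/-- Fundamental theorem of calculus along the ray through `w`. -/
lemma integral_Ioi_fderiv_ray {g : ℂ → ℂ} (hg : ContDiff ℝ 1 g) {R : ℝ}
    (hR : ∀ z, R < ‖z‖ → g z = 0) {w : ℂ} (hw : ‖w‖ = 1) :
    ∫ r in Set.Ioi (0 : ℝ), fderiv ℝ g (r * w) w = -g 0 := by
  have hray : ∀ r : ℝ, HasDerivAt (fun r : ℝ => g (r * w)) (fderiv ℝ g (r * w) w) r := by
    intro r
    have h1 : HasDerivAt (fun r : ℝ => (r : ℂ) * w) w r := by
      simpa using (Complex.ofRealCLM.hasDerivAt (x := r)).mul_const w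
    exact ((hg.differentiable one_ne_zero _).hasFDerivAt).comp_hasDerivAt r h1
  have hnorm : ∀ r : ℝ, R < r → R < ‖(r : ℂ) * w‖ := fun r hr => by
    simpa [hw] using lt_of_lt_of_le hr (le_abs_self r)
  have hzero : ∀ r : ℝ, R < r → fderiv ℝ g (r * w) w = 0 := by
    intro r hr
    have : g =ᶠ[nhds ((r : ℂ) * w)] fun _ => 0 := by
      filter_upwards [(isOpen_lt continuous_const continuous_norm).mem_nhds (hnorm r hr)] with z hz
      exact hR z hz
    simp [this.fderiv_eq]
  have hcont : Continuous fun r : ℝ => fderiv ℝ g (r * w) w :=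
    ((hg.continuous_fderiv one_ne_zero).comp (by fun_prop)).clm_apply continuous_const
  have hint : IntegrableOn (fun r : ℝ => fderiv ℝ g (r * w) w) (Set.Ioi 0) := by
    refine (hcont.continuousOn.integrableOn_compact (isCompact_Icc (a := 0) (b := R))
      ).of_forall_sdiff_eq_zero measurableSet_Ioi ?_
    rintro r ⟨h1, h2⟩
    exact hzero r (not_le.1 fun hr => h2 ⟨le_of_lt h1, hr⟩)
  have hlim : Filter.Tendsto (fun r : ℝ => g (r * w)) Filter.atTop (nhds 0) := by
    refine tendsto_const_nhds.congr' ?_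
    filter_upwards [Filter.eventually_gt_atTop R] with r hr
    exact (hR _ (hnorm r hr)).symm
  simpa using integral_Ioi_of_hasDerivAt_of_tendsto (hray 0).continuousAt.continuousWithinAt
    (fun r _ => hray r) hint hlim

/-- The angular derivative of a function integrates to zero over a circle. -/
lemma integral_angle_fderiv {g : ℂ → ℂ} (hg : ContDiff ℝ 1 g) {r : ℝ} (hr : 0 < r) :
    ∫ φ in Set.Ioo (-Real.pi) Real.pi,
      fderiv ℝ g (r * Complex.exp (φ * Complex.I)) (Complex.exp (φ * Complex.I) * Complex.I)
        = 0 := by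
  have hangle : ∀ φ : ℝ, HasDerivAt (fun φ : ℝ => g (r * Complex.exp (φ * Complex.I)))
      (r • fderiv ℝ g (r * Complex.exp (φ * Complex.I))
        (Complex.exp (φ * Complex.I) * Complex.I)) φ := by
    intro φ
    have h1 : HasDerivAt (fun φ : ℝ => (φ : ℂ) * Complex.I) Complex.I φ := by
      simpa using (Complex.ofRealCLM.hasDerivAt (x := φ)).mul_const Complex.I
    have h2 : HasDerivAt (fun φ : ℝ => (r : ℂ) * Complex.exp (φ * Complex.I))
        (r • (Complex.exp (φ * Complex.I) * Complex.I)) φ := by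
      simpa using h1.cexp.const_mul (r : ℂ)
    have h3 := ((hg.differentiable one_ne_zero _).hasFDerivAt).comp_hasDerivAt φ h2
    rwa [map_smul] at h3
  have hcont : Continuous fun φ : ℝ => fderiv ℝ g (r * Complex.exp (φ * Complex.I))
      (Complex.exp (φ * Complex.I) * Complex.I) :=
    ((hg.continuous_fderiv one_ne_zero).comp (by fun_prop)).clm_apply (by fun_prop)
  have h := intervalIntegral.integral_eq_sub_of_hasDerivAt (a := -Real.pi) (b := Real.pi)
    (fun φ _ => hangle φ) ((hcont.const_smul r).intervalIntegrable _ _)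
  rw [intervalIntegral.integral_smul, intervalIntegral.integral_of_le (by linarith [Real.pi_pos]),
    integral_Ioc_eq_integral_Ioo] at h
  have hexp : Complex.exp ((-Real.pi : ℝ) * Complex.I) = Complex.exp (Real.pi * Complex.I) := by
    rw [Complex.exp_pi_mul_I]
    simp [Complex.exp_neg]
  rw [hexp, sub_self] at h
  exact (smul_eq_zero.1 h).resolve_left hr.ne'

/-- In polar coordinates, `∂̄ = (w/2)(∂_w + i ∂_{iw})` for every direction `w`. -/
lemma wdbar_eq_polar {g : ℂ → ℂ} {z w : ℂ} (hw : ‖w‖ = 1) :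
    wdbar g z
      = w * (fderiv ℝ g z w + Complex.I * fderiv ℝ g z (w * Complex.I)) / 2 := by
  have hlin : ∀ u : ℂ, fderiv ℝ g z u
      = u.re * fderiv ℝ g z 1 + u.im * fderiv ℝ g z Complex.I := by
    intro u
    conv_lhs => rw [show u = u.re • (1 : ℂ) + u.im • Complex.I by simp [Complex.re_add_im]]
    rw [map_add, map_smul, map_smul, Complex.real_smul, Complex.real_smul]
  have hsq : (w.re : ℂ) ^ 2 + (w.im : ℂ) ^ 2 = 1 := by
    have := Complex.normSq_eq_norm_sq w
    rw [hw, Complex.normSq_apply] at this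
    exact_mod_cast (by linarith : w.re ^ 2 + w.im ^ 2 = 1)
  have hconj : w * ((w.re : ℂ) - w.im * Complex.I) = 1 := by
    linear_combination -((w.re : ℂ) - w.im * Complex.I) * Complex.re_add_im w + hsq - (w.im : ℂ) ^ 2 * Complex.I_sq
  rw [wdbar, hlin w, hlin (w * Complex.I)]
  simp only [Complex.mul_I_re, Complex.mul_I_im, Complex.ofReal_neg]
  linear_combination (-(fderiv ℝ g z 1 + Complex.I * fderiv ℝ g z Complex.I) / 2) * hconj
    - w * w.im * fderiv ℝ g z Complex.I / 2 * Complex.I_sq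

/-- The Cauchy kernel inverts `∂̄` on compactly supported `C¹` functions. -/
lemma integral_inv_mul_wdbar {g : ℂ → ℂ} (hg : ContDiff ℝ 1 g) (hc : HasCompactSupport g) :
    ∫ y, y⁻¹ * wdbar g y = -(Real.pi * g 0) := by
  obtain ⟨R, hR⟩ : ∃ R : ℝ, ∀ z, R < ‖z‖ → z ∉ tsupport g := by
    obtain ⟨R, hR⟩ := hc.isCompact.isBounded.exists_norm_le
    exact ⟨R, fun z hz hmem => absurd (hR z hmem) (not_le.2 hz)⟩
  have hg0 : ∀ z, R < ‖z‖ → g z = 0 := fun z hz => image_eq_zero_of_notMem_tsupport (hR z hz)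
  have hdg0 : ∀ z, R < ‖z‖ → fderiv ℝ g z = 0 := fun z hz =>
    image_eq_zero_of_notMem_tsupport fun h => hR z hz (tsupport_fderiv_subset ℝ h)
  let w : ℝ → ℂ := fun φ => Complex.exp (φ * Complex.I)
  have hw : ∀ φ, ‖w φ‖ = 1 := fun φ => Complex.norm_exp_ofReal_mul_I φ
  have hwc : Continuous w := by fun_prop
  let A : ℝ × ℝ → ℂ := fun p => fderiv ℝ g (p.1 * w p.2) (w p.2)
  let B : ℝ × ℝ → ℂ := fun p => fderiv ℝ g (p.1 * w p.2) (w p.2 * Complex.I)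
  have hD : Continuous fun p : ℝ × ℝ => fderiv ℝ g (p.1 * w p.2) :=
    (hg.continuous_fderiv one_ne_zero).comp (by fun_prop)
  have hD0 : ∀ p : ℝ × ℝ, R < p.1 → fderiv ℝ g (p.1 * w p.2) = 0 := fun p hp =>
    hdg0 _ (by simpa [hw] using lt_of_lt_of_le hp (le_abs_self p.1))
  have hA : IntegrableOn A (Set.Ioi (0 : ℝ) ×ˢ Set.Ioo (-Real.pi) Real.pi) :=
    integrableOn_polar_of_continuous (R := R) (hD.clm_apply (by fun_prop))
      fun p hp => by simp [A, hD0 p hp]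
  have hB : IntegrableOn B (Set.Ioi (0 : ℝ) ×ˢ Set.Ioo (-Real.pi) Real.pi) :=
    integrableOn_polar_of_continuous (R := R) (hD.clm_apply (by fun_prop))
      fun p hp => by simp [B, hD0 p hp]
  have hIA : ∫ p in Set.Ioi (0 : ℝ) ×ˢ Set.Ioo (-Real.pi) Real.pi, A p
      = -(2 * Real.pi * g 0) := by
    rw [Measure.volume_eq_prod, ← Measure.prod_restrict, integral_prod_symm]
    · simp only [A, integral_Ioi_fderiv_ray hg hg0 (hw _)]
      rw [setIntegral_const,
        Real.volume_real_Ioo_of_le (show -Real.pi ≤ Real.pi by linarith [Real.pi_pos]),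
        Complex.real_smul]
      push_cast
      ring
    · rwa [Measure.prod_restrict]
  have hIB : ∫ p in Set.Ioi (0 : ℝ) ×ˢ Set.Ioo (-Real.pi) Real.pi, B p = 0 := by
    rw [Measure.volume_eq_prod, setIntegral_prod _ hB]
    exact setIntegral_eq_zero_of_forall_eq_zero fun r hr => integral_angle_fderiv hg hr
  rw [← Complex.integral_comp_polarCoord_symm, polarCoord_target]
  have hpt : ∀ p ∈ Set.Ioi (0 : ℝ) ×ˢ Set.Ioo (-Real.pi) Real.pi,
      p.1 • ((Complex.polarCoord.symm p)⁻¹ * wdbar g (Complex.polarCoord.symm p))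
        = (1 / 2 : ℂ) * (A p + Complex.I * B p) := by
    rintro ⟨r, φ⟩ ⟨hr, -⟩
    have hr0 : (r : ℂ) ≠ 0 := by exact_mod_cast (ne_of_gt hr)
    have hw0 : w φ ≠ 0 := Complex.exp_ne_zero _
    have hpol : Complex.polarCoord.symm (r, φ) = r * w φ := by
      simp [w, Complex.exp_mul_I]
    rw [hpol, wdbar_eq_polar (hw φ), Complex.real_smul]
    simp only [A, B]
    field_simp
  rw [setIntegral_congr_fun (measurableSet_Ioi.prod measurableSet_Ioo) hpt,
    integral_const_mul, integral_add hA (hB.const_mul _), integral_const_mul, hIA, hIB]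
  ring

lemma locallyIntegrable_Kker (θ : ℝ) : LocallyIntegrable (Kker θ) volume := by
  refine locallyIntegrable_of_norm_le_rpow (C := (2 * Real.pi)⁻¹) (α := 1)
    (by simp [Complex.finrank_real_complex]) (by simp [Complex.finrank_real_complex]) ?_ ?_
  · refine Filter.Eventually.of_forall fun z => ?_
    simp [Kker, Real.rpow_neg_one, abs_of_pos Real.pi_pos,
      mul_comm]
  · have : Measurable (Kker θ) := by unfold Kker; fun_prop
    exact this.aestronglyMeasurable

/-- `∂̄ (K ∗ f) = e^{iθ} f / 2` for compactly supported `C¹` functions `f`. -/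
lemma wdbar_Kconv (θ : ℝ) {f : ℂ → ℂ} (hf : ContDiff ℝ 1 f) (hc : HasCompactSupport f) (z : ℂ) :
    wdbar (Kconv θ f) z = Complex.exp (θ * Complex.I) * f z / 2 := by
  have hKc : Kconv θ f = convolution (Kker θ) f (ContinuousLinearMap.mul ℝ ℂ) volume := by
    funext x
    rw [convolution_def, Kconv, ← integral_sub_left_eq_self _ volume x]
    simp
  have hdf : HasCompactSupport (fderiv ℝ f) := hc.fderiv ℝ
  have hdc : Continuous (fderiv ℝ f) := hf.continuous_fderiv one_ne_zero
  have hder : ∀ u, fderiv ℝ (Kconv θ f) z u = ∫ y, Kker θ y * fderiv ℝ f (z - y) u := by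
    intro u
    rw [hKc, (hc.hasFDerivAt_convolution_right (ContinuousLinearMap.mul ℝ ℂ)
      (locallyIntegrable_Kker θ) hf z).fderiv, convolution_precompR_apply _
      (locallyIntegrable_Kker θ) hdf hdc, convolution_def]
    simp
  have hint : ∀ u, Integrable fun y => Kker θ y * fderiv ℝ f (z - y) u := by
    intro u
    exact (hdf.comp_left (g := fun L : ℂ →L[ℝ] ℂ => L u) (by simp)).convolutionExists_right
      (ContinuousLinearMap.mul ℝ ℂ) (locallyIntegrable_Kker θ)
      (hdc.clm_apply continuous_const) z
  let g : ℂ → ℂ := fun y => f (z - y)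
  have hg : ContDiff ℝ 1 g := by fun_prop
  have hgc : HasCompactSupport g := hc.comp_homeomorph (Homeomorph.subLeft z)
  have hgd : ∀ y u, fderiv ℝ g y u = -fderiv ℝ f (z - y) u := by
    intro y u
    have h1 : HasFDerivAt (fun y : ℂ => z - y) (-ContinuousLinearMap.id ℝ ℂ) y :=
      (hasFDerivAt_id y).const_sub z
    have h2 := (hf.differentiable one_ne_zero (z - y)).hasFDerivAt.comp y h1
    rw [show g = f ∘ fun y => z - y from rfl, h2.fderiv]
    simp
  have hpt : ∀ y, Kker θ y * fderiv ℝ f (z - y) 1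
      + Complex.I * (Kker θ y * fderiv ℝ f (z - y) Complex.I)
        = -(Complex.exp (θ * Complex.I) / Real.pi) * (y⁻¹ * wdbar g y) := by
    intro y
    rw [wdbar, hgd, hgd, Kker, div_eq_mul_inv _ (2 * (Real.pi : ℂ) * y), mul_inv, mul_inv]
    ring
  have hpi : (Real.pi : ℂ) ≠ 0 := by exact_mod_cast Real.pi_ne_zero
  rw [wdbar, hder, hder, ← integral_const_mul, ← integral_add (hint _) ((hint _).const_mul _)]
  simp only [hpt]
  rw [integral_const_mul, integral_inv_mul_wdbar hg hgc]
  simp only [g, sub_zero]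
  field_simp

/-- Time and space derivatives of a smooth time-dependent map commute. -/
lemma hasDerivAt_fderiv_space {X : ℝ → ℂ → ℂ}
    (hX : ContDiff ℝ (⊤ : ℕ∞) (fun p : ℝ × ℂ => X p.1 p.2)) (t : ℝ) (z u : ℂ) :
    HasDerivAt (fun s => fderiv ℝ (X s) z u)
      (fderiv ℝ (fun x => deriv (fun s => X s x) t) z u) t := by
  let G : ℝ × ℂ → ℂ := fun p => X p.1 p.2
  have hG : ContDiff ℝ (⊤ : ℕ∞) G := hX
  have hGd : Differentiable ℝ G := hG.differentiable (by simp)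
  have hG' : Differentiable ℝ (fderiv ℝ G) :=
    (hG.fderiv_right (m := 1) (by norm_cast)).differentiable one_ne_zero
  have hleft : ∀ s x, HasFDerivAt (fun y : ℂ => ((s, y) : ℝ × ℂ))
      (ContinuousLinearMap.inr ℝ ℝ ℂ) x := fun s x => hasFDerivAt_prodMk_right s x
  have hright : ∀ s x, HasDerivAt (fun s : ℝ => ((s, x) : ℝ × ℂ)) (1, 0) s := fun s x =>
    (hasDerivAt_id s).prodMk (hasDerivAt_const s x)
  have hspace : ∀ s, fderiv ℝ (X s) z u = fderiv ℝ G (s, z) (0, u) := by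
    intro s
    have h : HasFDerivAt (X s) ((fderiv ℝ G (s, z)).comp (ContinuousLinearMap.inr ℝ ℝ ℂ)) z :=
      (hGd (s, z)).hasFDerivAt.comp z (hleft s z)
    rw [h.fderiv]
    simp
  have htime : ∀ x, deriv (fun s => X s x) t = fderiv ℝ G (t, x) (1, 0) := by
    intro x
    have h : HasDerivAt (fun s => X s x) (fderiv ℝ G (t, x) (1, 0)) t :=
      HasFDerivAt.comp_hasDerivAt (f := fun s => (s, x)) t (hGd (t, x)).hasFDerivAt (hright t x)
    exact h.deriv
  have hsymm : IsSymmSndFDerivAt ℝ G (t, z) :=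
    hG.contDiffAt.isSymmSndFDerivAt
      (by rw [minSmoothness_of_isRCLikeNormedField]; exact WithTop.coe_le_coe.2 le_top)
  simp only [hspace, htime]
  have h1 : HasDerivAt (fun s => fderiv ℝ G (s, z) (0, u))
      (fderiv ℝ (fderiv ℝ G) (t, z) (1, 0) (0, u)) t :=
    (ContinuousLinearMap.apply ℝ ℂ ((0, u) : ℝ × ℂ)).hasFDerivAt.comp_hasDerivAt t
      ((hG' (t, z)).hasFDerivAt.comp_hasDerivAt t (hright t z))
  have h2 : HasFDerivAt (fun x => fderiv ℝ G (t, x) (1, 0))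
      ((ContinuousLinearMap.apply ℝ ℂ ((1, 0) : ℝ × ℂ)).comp
        ((fderiv ℝ (fderiv ℝ G) (t, z)).comp (ContinuousLinearMap.inr ℝ ℝ ℂ))) z :=
    (ContinuousLinearMap.apply ℝ ℂ ((1, 0) : ℝ × ℂ)).hasFDerivAt.comp z
      ((hG' (t, z)).hasFDerivAt.comp z (hleft t z))
  have h3 : fderiv ℝ (fun x => fderiv ℝ G (t, x) (1, 0)) z u
      = fderiv ℝ (fderiv ℝ G) (t, z) (0, u) (1, 0) := by
    rw [h2.fderiv]
    simp
  rw [h3, hsymm.eq]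
  exact h1

/-- in the smooth setting, with `μ(t,z) = ∂̄X(t,z)/∂X(t,z)`, the time
derivative of the Beltrami coefficient at `t = 0` is given by the initial vorticity:
`(d/dt)μ(t,z)|_{t=0} = ∂̄v(0,z) = e^{iθ}ω₀(z)/2`. -/
theorem beltrami_initial_time_derivative (S : SmoothSetting) :
    ∀ z : ℂ,
      deriv (fun t => wdbar (S.X t) z / wdz (S.X t) z) 0
          = wdbar (Kconv S.θ (fun y => (S.ω₀ y : ℂ))) z ∧
      wdbar (Kconv S.θ (fun y => (S.ω₀ y : ℂ))) z
          = Complex.exp (S.θ * Complex.I) * (S.ω₀ z : ℂ) / 2 := by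
  intro z
  refine ⟨?_, wdbar_Kconv S.θ (Complex.ofRealCLM.contDiff.comp (S.hω₀smooth.of_le (by simp)))
    (S.hω₀supp.comp_left (g := fun x : ℝ => (x : ℂ)) Complex.ofReal_zero) z⟩
  have hv : (fun x => deriv (fun s => S.X s x) 0) = Kconv S.θ (fun y => (S.ω₀ y : ℂ)) := by
    funext x
    rw [S.hXflow 0 ⟨le_rfl, S.hT.le⟩ x, S.hXinit, S.hωinit]
  have hder : ∀ u, HasDerivAt (fun s => fderiv ℝ (S.X s) z u)
      (fderiv ℝ (Kconv S.θ (fun y => (S.ω₀ y : ℂ))) z u) 0 := fun u =>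
    hv ▸ hasDerivAt_fderiv_space S.hXsmooth 0 z u
  have hX0 : S.X 0 = fun x => x := funext S.hXinit
  have hbar : HasDerivAt (fun t => wdbar (S.X t) z)
      (wdbar (Kconv S.θ (fun y => (S.ω₀ y : ℂ))) z) 0 :=
    ((hder 1).add ((hder Complex.I).const_mul Complex.I)).div_const 2
  have hdz : HasDerivAt (fun t => wdz (S.X t) z)
      (wdz (Kconv S.θ (fun y => (S.ω₀ y : ℂ))) z) 0 :=
    ((hder 1).sub ((hder Complex.I).const_mul Complex.I)).div_const 2
  have hbar0 : wdbar (S.X 0) z = 0 := by simp [wdbar, hX0]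
  have hdz0 : wdz (S.X 0) z = 1 := by simp [wdz, hX0]
  have hquot := hbar.fun_div hdz (by simp [hdz0])
  rw [hquot.deriv, hbar0, hdz0]
  simp
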